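/- arXiv:1810.08763 — 2 statements merged into one kernel-verified Lean document; each statement's English description precedes it below -/
import Mathlib

section
/- Every Miller-indestructible MAD family is +-Ramsey. -/
/-- The restriction `f↾n` of `f : ω → ω`, as a finite sequence. -/
def res (f : ℕ → ℕ) (n : ℕ) : List ℕ := (List.range n).map f

/-- A tree on `ω`: a set of finite sequences closed under initial segments. -/
def IsTree (T : Set (List ℕ)) : Prop := ∀ s ∈ T, ∀ t, t <+: s → t ∈ T

/-- The successor set `suc_T(s) = {n : s⌢n ∈ T}`. -/
def sucT (T : Set (List ℕ)) (s : List ℕ) : Set ℕ := {n | s ++ [n] ∈ T}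

/-- `f ∈ [T]` is a branch of `T`. -/
def IsBranch (T : Set (List ℕ)) (f : ℕ → ℕ) : Prop := ∀ n, res f n ∈ T

/-- An almost disjoint family: infinite sets with pairwise finite intersections. -/
def IsADF (𝒜 : Set (Set ℕ)) : Prop :=
  (∀ A ∈ 𝒜, A.Infinite) ∧ ∀ A ∈ 𝒜, ∀ B ∈ 𝒜, A ≠ B → (A ∩ B).Finite

/-- A maximal almost disjoint family. -/
def IsMAD (𝒜 : Set (Set ℕ)) : Prop :=
  IsADF 𝒜 ∧ ∀ X : Set ℕ, X.Infinite → ∃ A ∈ 𝒜, (X ∩ A).Infinite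

/-- `X ∈ I(𝒜)`: the ideal generated by `𝒜` together with the finite sets. -/
def InIdeal (𝒜 : Set (Set ℕ)) (X : Set ℕ) : Prop :=
  ∃ F : Finset (Set ℕ), ↑F ⊆ 𝒜 ∧ (X \ ⋃ A ∈ F, A).Finite

/-- `X` is `I(𝒜)`-positive. -/
def Positive (𝒜 : Set (Set ℕ)) (X : Set ℕ) : Prop := ¬ InIdeal 𝒜 X

/-- `𝒜` is `+`-Ramsey: every tree all of whose successor sets are `I(𝒜)`-positive
has a branch whose range is `I(𝒜)`-positive. -/
def PlusRamsey (𝒜 : Set (Set ℕ)) : Prop :=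
  ∀ T : Set (List ℕ), [] ∈ T → IsTree T → (∀ s ∈ T, Positive 𝒜 (sucT T s)) →
    ∃ f : ℕ → ℕ, IsBranch T f ∧ Positive 𝒜 (Set.range f)

/-- A Miller (superperfect) tree: a nonempty tree of strictly increasing sequences in
which every node extends to an infinitely-splitting node. -/
def IsMiller (p : Set (List ℕ)) : Prop :=
  p.Nonempty ∧ IsTree p ∧ (∀ s ∈ p, List.Chain' (· < ·) s) ∧
    ∀ s ∈ p, ∃ t ∈ p, s <+: t ∧ (sucT p t).Infinite

/-- The (infinitely-)splitting nodes of `p`. -/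
def SplitNodes (p : Set (List ℕ)) : Set (List ℕ) := {s | s ∈ p ∧ (sucT p s).Infinite}

/-- `Sp(p,f) = {f(n) : f↾n ∈ Split(p)}`. -/
def Sp (p : Set (List ℕ)) (f : ℕ → ℕ) : Set ℕ :=
  {m | ∃ n, res f n ∈ SplitNodes p ∧ f n = m}

/-- `[p]_split = {Sp(p,f) : f ∈ [p]}`. -/
def splitSets (p : Set (List ℕ)) : Set (Set ℕ) := {X | ∃ f, IsBranch p f ∧ X = Sp p f}

/-- A (nice) Miller-forcing name for a subset of `ω`: `x n` is the (open) set of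
conditions forcing `n` into the named set. -/
def IsMName (x : ℕ → Set (Set (List ℕ))) : Prop :=
  ∀ n, ∀ p ∈ x n, IsMiller p ∧ ∀ q, IsMiller q → q ⊆ p → q ∈ x n

/-- `p` forces the named set to be infinite. -/
def ForcesInfinite (p : Set (List ℕ)) (x : ℕ → Set (Set (List ℕ))) : Prop :=
  ∀ q, IsMiller q → q ⊆ p → ∀ k, ∃ r, IsMiller r ∧ r ⊆ q ∧ ∃ n ≥ k, r ∈ x n

/-- `p` forces the named set to meet `A` infinitely. -/
def ForcesInfMeet (p : Set (List ℕ)) (x : ℕ → Set (Set (List ℕ))) (A : Set ℕ) : Prop :=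
  ∀ q, IsMiller q → q ⊆ p → ∀ k, ∃ r, IsMiller r ∧ r ⊆ q ∧ ∃ n ≥ k, n ∈ A ∧ r ∈ x n

/-- `𝒜` remains MAD after Miller forcing: for every condition `p` and every name `x`
forced to be an infinite subset of `ω`, some stronger condition forces `x` to meet
some member of `𝒜` infinitely. -/
def MillerIndestructible (𝒜 : Set (Set ℕ)) : Prop :=
  ∀ p, IsMiller p → ∀ x, IsMName x → ForcesInfinite p x →
    ∃ q, IsMiller q ∧ q ⊆ p ∧ ∃ A ∈ 𝒜, ForcesInfMeet q x A

theorem IsMAD.infinite_meeting_of_positive {𝒜 : Set (Set ℕ)} (hmad : IsMAD 𝒜) {X : Set ℕ}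
    (hX : Positive 𝒜 X) : {A | A ∈ 𝒜 ∧ (X ∩ A).Infinite}.Infinite := by
  intro hfin
  refine hX ⟨hfin.toFinset, fun A hA => ((hfin.mem_toFinset).1 hA).1, ?_⟩
  by_contra hinf
  obtain ⟨A, hA, hXA⟩ := hmad.2 _ hinf
  have hAF : A ∈ hfin.toFinset :=
    hfin.mem_toFinset.2 ⟨hA, hXA.mono (Set.inter_subset_inter_left _ Set.sdiff_subset)⟩
  refine hXA (Set.finite_empty.subset ?_)
  rintro n ⟨⟨-, hn⟩, hnA⟩
  exact hn (Set.mem_biUnion hAF hnA)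

theorem IsADF.infinite_diff_biUnion {𝒜 : Set (Set ℕ)} (had : IsADF 𝒜) {F : Finset (Set ℕ)}
    (hF : ↑F ⊆ 𝒜) {B : Set ℕ} (hB : B ∈ 𝒜) (hBF : B ∉ F) {X : Set ℕ} (hX : (X ∩ B).Infinite) :
    ((X ∩ B) \ ⋃ A ∈ F, A).Infinite := by
  have hfin : (⋃ A ∈ F, B ∩ A).Finite :=
    F.finite_toSet.biUnion fun A hA => had.2 B hB A (hF hA) fun h => hBF (h ▸ hA)
  refine (hX.sdiff hfin).mono ?_
  rintro n ⟨hn, hn'⟩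
  refine ⟨hn, fun hnF => hn' ?_⟩
  simp only [Set.mem_iUnion] at hnF ⊢
  obtain ⟨A, hA, hnA⟩ := hnF
  exact ⟨A, hA, hn.2, hnA⟩

theorem IsADF.positive_of_infinite {𝒜 : Set (Set ℕ)} (had : IsADF 𝒜) {X : Set ℕ}
    (hX : {A | A ∈ 𝒜 ∧ (X ∩ A).Infinite}.Infinite) : Positive 𝒜 X := by
  rintro ⟨F, hF, hfin⟩
  obtain ⟨B, ⟨hB, hXB⟩, hBF⟩ := hX.exists_notMem_finset F
  exact had.infinite_diff_biUnion hF hB hBF hXB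
    (hfin.subset (Set.sdiff_subset_sdiff_left Set.inter_subset_left))

/-- Greedy choice of pairwise distinct representatives from a sequence of infinite sets. -/
noncomputable def distinctRep {α : Type*} (D : ℕ → Set α) (hD : ∀ n, (D n).Infinite) (n : ℕ) : α :=
  ((hD n).sdiff (Set.finite_range fun i : Fin n => distinctRep D hD i)).nonempty.choose
termination_by n

theorem distinctRep_spec {α : Type*} (D : ℕ → Set α) (hD : ∀ n, (D n).Infinite) (n : ℕ) :
    distinctRep D hD n ∈ D n \ Set.range fun i : Fin n => distinctRep D hD i := by
  rw [distinctRep]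
  exact ((hD n).sdiff (Set.finite_range fun i : Fin n => distinctRep D hD i)).nonempty.choose_spec

theorem exists_injective_forall_mem {ι α : Type*} [Encodable ι] (D : ι → Set α)
    (hD : ∀ i, (D i).Infinite) : ∃ g : ι → α, Function.Injective g ∧ ∀ i, g i ∈ D i := by
  rcases isEmpty_or_nonempty ι with hι | ⟨⟨i₀⟩⟩
  · exact ⟨isEmptyElim, fun i => isEmptyElim i, fun i => isEmptyElim i⟩
  let E : ℕ → Set α := fun n => D ((Encodable.decode n).getD i₀)
  have hE : ∀ n, (E n).Infinite := fun n => hD _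
  have hne : ∀ m n, m < n → distinctRep E hE m ≠ distinctRep E hE n := fun m n hmn h =>
    (distinctRep_spec E hE n).2 ⟨⟨m, hmn⟩, h⟩
  refine ⟨fun i => distinctRep E hE (Encodable.encode i), fun i j hij => ?_, fun i => ?_⟩
  · by_contra hne'
    rcases lt_or_gt_of_ne (fun h => hne' (Encodable.encode_injective h)) with h | h
    · exact hne _ _ h hij
    · exact hne _ _ h hij.symm
  · simpa [E] using (distinctRep_spec E hE (Encodable.encode i)).1

/-- The nodes of `p` comparable with `u`. -/
def nodeRestrict (p : Set (List ℕ)) (u : List ℕ) : Set (List ℕ) :=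
  {t | t ∈ p ∧ (t <+: u ∨ u <+: t)}

theorem nodeRestrict_subset (p : Set (List ℕ)) (u : List ℕ) : nodeRestrict p u ⊆ p :=
  fun _ ht => ht.1

theorem IsMiller.nodeRestrict {p : Set (List ℕ)} (hp : IsMiller p) {u : List ℕ} (hu : u ∈ p) :
    IsMiller (nodeRestrict p u) := by
  obtain ⟨-, htree, hchain, hsplit⟩ := hp
  refine ⟨⟨u, hu, Or.inl List.prefix_rfl⟩, ?_, fun s hs => hchain s hs.1, ?_⟩
  · rintro s ⟨hs, hsu⟩ t hts
    refine ⟨htree s hs t hts, ?_⟩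
    rcases hsu with h | h
    · exact Or.inl (hts.trans h)
    · exact List.prefix_or_prefix_of_prefix hts h
  · rintro s ⟨hs, hsu⟩
    have aux : ∀ v ∈ p, u <+: v → s <+: v →
        ∃ t ∈ _root_.nodeRestrict p u, s <+: t ∧ (sucT (_root_.nodeRestrict p u) t).Infinite := by
      intro v hv huv hsv
      obtain ⟨t, ht, hvt, hinf⟩ := hsplit v hv
      refine ⟨t, ⟨ht, Or.inr (huv.trans hvt)⟩, hsv.trans hvt, hinf.mono fun n hn => ?_⟩
      exact ⟨hn, Or.inr ((huv.trans hvt).trans (List.prefix_append _ _))⟩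
    rcases hsu with h | h
    · exact aux u hu List.prefix_rfl h
    · exact aux s hs h List.prefix_rfl

theorem IsMiller.exists_long {p : Set (List ℕ)} (hp : IsMiller p) (l : ℕ) :
    ∃ s ∈ p, l ≤ s.length := by
  induction l with
  | zero => exact hp.1.imp fun s hs => ⟨hs, Nat.zero_le _⟩
  | succ l ih =>
    obtain ⟨s, hs, hl⟩ := ih
    obtain ⟨t, -, hst, hinf⟩ := hp.2.2.2 s hs
    obtain ⟨n, hn⟩ := hinf.nonempty
    refine ⟨t ++ [n], hn, ?_⟩
    have := hst.length_le
    simp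
    omega

theorem IsMiller.exists_long_splitting {p : Set (List ℕ)} (hp : IsMiller p) (l : ℕ) :
    ∃ s ∈ p, l ≤ s.length ∧ (sucT p s).Infinite := by
  obtain ⟨s, hs, hl⟩ := hp.exists_long l
  obtain ⟨t, ht, hst, hinf⟩ := hp.2.2.2 s hs
  exact ⟨t, ht, hl.trans hst.length_le, hinf⟩

/-- The name for the range of the generic branch minus the union of `F`. -/
def branchName (F : Finset (Set ℕ)) (n : ℕ) : Set (Set (List ℕ)) :=
  {q | IsMiller q ∧ n ∉ (⋃ A ∈ F, A) ∧ ∃ l, ∀ t ∈ q, l ≤ t.length → n ∈ t}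

theorem isMName_branchName (F : Finset (Set ℕ)) : IsMName (branchName F) := by
  rintro n p ⟨hp, hn, l, hl⟩
  exact ⟨hp, fun q hq hqp => ⟨hq, hn, l, fun t ht => hl t (hqp ht)⟩⟩

/-- `p` forces the range of the generic branch to meet `B` infinitely. -/
abbrev ForcesBranchMeet (p : Set (List ℕ)) (B : Set ℕ) : Prop := ForcesInfMeet p (branchName ∅) B

theorem ForcesInfMeet.mono {p q : Set (List ℕ)} {x : ℕ → Set (Set (List ℕ))} {B : Set ℕ}
    (h : ForcesInfMeet p x B) (hqp : q ⊆ p) : ForcesInfMeet q x B :=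
  fun r hr hrq => h r hr (hrq.trans hqp)

theorem ForcesInfMeet.forcesBranchMeet {p : Set (List ℕ)} {F : Finset (Set ℕ)} {B : Set ℕ}
    (h : ForcesInfMeet p (branchName F) B) : ForcesBranchMeet p B := by
  intro q hq hqp k
  obtain ⟨r, hr, hrq, n, hn, hnB, -, -, hl⟩ := h q hq hqp k
  exact ⟨r, hr, hrq, n, hn, hnB, hr, by simp, hl⟩

theorem ForcesInfMeet.notMem {p : Set (List ℕ)} (hp : IsMiller p) {F : Finset (Set ℕ)} {B : Set ℕ}
    (h : ForcesInfMeet p (branchName F) B) : B ∉ F := by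
  intro hB
  obtain ⟨-, -, -, n, -, hnB, -, hn, -⟩ := h p hp subset_rfl 0
  exact hn (Set.mem_biUnion hB hnB)

theorem exists_refinement_meeting {p : Set (List ℕ)} (hp : IsMiller p) (F : Finset (Set ℕ))
    (hF : ∀ B ∈ F, ForcesBranchMeet p B) (k : ℕ) :
    ∃ r, IsMiller r ∧ r ⊆ p ∧ ∃ l, ∀ B ∈ F, ∃ n ≥ k, n ∈ B ∧ ∀ t ∈ r, l ≤ t.length → n ∈ t := by
  classical
  induction F using Finset.induction_on with
  | empty => exact ⟨p, hp, subset_rfl, 0, by simp⟩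
  | insert A F _ ih =>
    obtain ⟨r, hr, hrp, l, hl⟩ := ih fun B hB => hF B (Finset.mem_insert_of_mem hB)
    obtain ⟨q, hq, hqr, n, hn, hnA, -, -, l', hl'⟩ :=
      hF A (Finset.mem_insert_self _ _) r hr hrp k
    refine ⟨q, hq, hqr.trans hrp, max l l', fun B hB => ?_⟩
    rcases Finset.mem_insert.1 hB with rfl | hB
    · exact ⟨n, hn, hnA, fun t ht h => hl' t ht ((le_max_right _ _).trans h)⟩
    · obtain ⟨m, hm, hmB, hmt⟩ := hl B hB
      exact ⟨m, hm, hmB, fun t ht h => hmt t (hqr ht) ((le_max_left _ _).trans h)⟩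

/-- A tree below which the generic branch is forced to have positive range contains a branch
with positive range, provided `𝒜` is Miller-indestructible. -/
theorem exists_branch_positive {𝒜 : Set (Set ℕ)} (had : IsADF 𝒜) (hind : MillerIndestructible 𝒜)
    {S : Set (List ℕ)} (hS : IsMiller S)
    (hpos : ∀ F : Finset (Set ℕ), ↑F ⊆ 𝒜 → ∀ p, IsMiller p → p ⊆ S →
      ForcesInfinite p (branchName F)) :
    ∃ f, IsBranch S f ∧ Positive 𝒜 (Set.range f) := by
  classical
  let Inv : Set (List ℕ) × Finset (Set ℕ) × List ℕ → Prop := fun σ =>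
    IsMiller σ.1 ∧ σ.1 ⊆ S ∧ ↑σ.2.1 ⊆ 𝒜 ∧ (∀ B ∈ σ.2.1, ForcesBranchMeet σ.1 B) ∧
      σ.2.2 ∈ σ.1 ∧ ∀ t ∈ σ.1, t <+: σ.2.2 ∨ σ.2.2 <+: t
  have step : ∀ σ : {σ // Inv σ}, ∃ τ : {σ // Inv σ}, σ.1.2.1 ⊂ τ.1.2.1 ∧
      σ.1.2.2 <+: τ.1.2.2 ∧ σ.1.2.2.length < τ.1.2.2.length ∧
      ∀ B ∈ τ.1.2.1, ∃ n ≥ σ.1.2.2.length, n ∈ B ∧ n ∈ τ.1.2.2 := by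
    rintro ⟨⟨p, F, u⟩, hp, hpS, hF, hFp, hu, hpu⟩
    dsimp only at hp hpS hF hFp hu hpu ⊢
    obtain ⟨q, hq, hqp, A, hA, hqA⟩ := hind p hp _ (isMName_branchName F) (hpos F hF p hp hpS)
    have hmeet : ∀ B ∈ insert A F, ForcesBranchMeet q B := by
      intro B hB
      rcases Finset.mem_insert.1 hB with rfl | hB
      · exact hqA.forcesBranchMeet
      · exact (hFp B hB).mono hqp
    obtain ⟨r, hr, hrq, l, hl⟩ := exists_refinement_meeting hq (insert A F) hmeet u.length
    obtain ⟨v, hv, hvl⟩ := hr.exists_long (max l (u.length + 1))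
    have hlen : u.length < v.length := (le_max_right _ _).trans hvl
    refine ⟨⟨(nodeRestrict r v, insert A F, v), hr.nodeRestrict hv,
      (nodeRestrict_subset r v).trans (hrq.trans (hqp.trans hpS)), ?_, fun B hB =>
        (hmeet B hB).mono ((nodeRestrict_subset r v).trans hrq), ⟨hv, Or.inl List.prefix_rfl⟩,
        fun t ht => ht.2⟩, Finset.ssubset_insert (hqA.notMem hq), ?_, hlen, ?_⟩
    · intro B hB
      rcases Finset.mem_insert.1 hB with rfl | hB
      · exact hA
      · exact hF hB
    · rcases hpu v (hqp (hrq hv)) with h | h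
      · exact absurd h.length_le (by omega)
      · exact h
    · intro B hB
      obtain ⟨n, hn, hnB, hnt⟩ := hl B hB
      exact ⟨n, hn, hnB, hnt v hv ((le_max_left _ _).trans hvl)⟩
  obtain ⟨s, hs⟩ := hS.1
  have hinit : Inv (nodeRestrict S s, ∅, s) :=
    ⟨hS.nodeRestrict hs, nodeRestrict_subset S s, by simp, by simp,
      ⟨hs, Or.inl List.prefix_rfl⟩, fun t ht => ht.2⟩
  choose next hFss hpre hlen hmem using step
  let σ : ℕ → {σ // Inv σ} := fun i => Nat.rec ⟨_, hinit⟩ (fun _ => next) i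
  let u : ℕ → List ℕ := fun i => (σ i).1.2.2
  let F : ℕ → Finset (Set ℕ) := fun i => (σ i).1.2.1
  have hui : ∀ i, i ≤ (u i).length := by
    intro i
    induction i with
    | zero => exact Nat.zero_le _
    | succ i ih => exact lt_of_le_of_lt ih (hlen (σ i))
  have humono : ∀ i j, i ≤ j → u i <+: u j := by
    intro i j hij
    induction hij with
    | refl => exact List.prefix_rfl
    | @step m hij ih => exact ih.trans (hpre (σ m))
  have hFlt : ∀ i, F i ⊂ F (i + 1) := fun i => hFss (σ i)
  have hFmono : Monotone F := monotone_nat_of_le_succ fun i => (hFlt i).subset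
  have hFcard : ∀ i, i ≤ (F i).card := by
    intro i
    induction i with
    | zero => exact Nat.zero_le _
    | succ i ih => exact lt_of_le_of_lt ih (Finset.card_lt_card (hFlt i))
  let f : ℕ → ℕ := fun j => (u (j + 1)).getD j 0
  have hf : ∀ i j (h : j < (u i).length), f j = (u i)[j] := by
    intro i j h
    have hj : j < (u (j + 1)).length := hui (j + 1)
    have : f j = (u (j + 1))[j] := by simp [f, hj]
    rw [this]
    rcases le_total i (j + 1) with hij | hij
    · exact ((humono _ _ hij).getElem h).symm
    · exact (humono _ _ hij).getElem hj
  have hres : ∀ i, res f i <+: u i := by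
    intro i
    rw [List.prefix_iff_eq_take]
    apply List.ext_getElem
    · simp [res, hui i]
    · intro j h₁ h₂
      have hj : j < i := by simpa [res] using h₁
      simpa [res] using hf i j (hj.trans_le (hui i))
  refine ⟨f, fun n => ?_, had.positive_of_infinite ?_⟩
  · exact hS.2.1 _ ((σ n).2.2.1 (σ n).2.2.2.2.2.1) _ (hres n)
  · have hsub : ∀ i, ↑(F i) ⊆ {A | A ∈ 𝒜 ∧ (Set.range f ∩ A).Infinite} := by
      intro i A hA
      refine ⟨(σ i).2.2.2.1 hA, Set.infinite_iff_exists_gt.2 fun k => ?_⟩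
      have hA' : A ∈ F (max i (k + 1) + 1) :=
        hFmono ((le_max_left i (k + 1)).trans (Nat.le_succ _)) hA
      obtain ⟨n, hn, hnA, hnu⟩ := hmem (σ (max i (k + 1))) A hA'
      obtain ⟨j, hj, rfl⟩ := List.getElem_of_mem hnu
      exact ⟨_, ⟨⟨j, hf (max i (k + 1) + 1) j hj⟩, hnA⟩,
        ((le_max_right i (k + 1)).trans (hui _)).trans hn⟩
    intro hfin
    have h₁ : (F (hfin.toFinset.card + 1)).card ≤ hfin.toFinset.card :=
      Finset.card_le_card fun A hA => hfin.mem_toFinset.2 (hsub (hfin.toFinset.card + 1) hA)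
    have h₂ := hFcard (hfin.toFinset.card + 1)
    omega

/-- The increasing nodes of `T` that pick each successor of `t` inside `g t`. -/
def selectedSubtree (T : Set (List ℕ)) (g : List ℕ → Set ℕ) : Set (List ℕ) :=
  {s | s ∈ T ∧ List.IsChain (· < ·) s ∧ ∀ t n, t ++ [n] <+: s → n ∈ g t}

theorem isMiller_selectedSubtree {T : Set (List ℕ)} (hnil : [] ∈ T) (hT : IsTree T)
    {g : List ℕ → Set ℕ} (hg : ∀ s ∈ T, (sucT T s ∩ g s).Infinite) :
    IsMiller (selectedSubtree T g) := by
  refine ⟨⟨[], hnil, by simp, by simp⟩, ?_, fun s hs => hs.2.1, fun s hs => ⟨s, hs,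
    List.prefix_rfl, ?_⟩⟩
  · rintro s ⟨hs, hchain, hsg⟩ t hts
    exact ⟨hT s hs t hts, hchain.prefix hts, fun v n hv => hsg v n (hv.trans hts)⟩
  · refine ((hg s hs.1).sdiff (Set.finite_Iic s.sum)).mono ?_
    rintro n ⟨⟨hnT, hng⟩, hn⟩
    rw [Set.mem_Iic, not_le] at hn
    refine ⟨hnT, ?_, fun t m htm => ?_⟩
    · rw [List.isChain_append]
      refine ⟨hs.2.1, by simp, ?_⟩
      intro x hx y hy
      have hxs : x ≤ s.sum := List.le_sum_of_mem (List.mem_of_mem_getLast? hx)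
      simp at hy
      omega
    · rcases List.prefix_concat_iff.1 htm with h | h
      · obtain ⟨rfl, h⟩ := List.append_inj' h rfl
        simp at h
        exact h ▸ hng
      · exact hs.2.2 t m h

theorem forcesInfinite_branchName {𝒜 : Set (Set ℕ)} (had : IsADF 𝒜) {T : Set (List ℕ)}
    {g : List ℕ → Set ℕ} (hinj : Function.Injective g) (hg : ∀ s, g s ∈ 𝒜)
    {F : Finset (Set ℕ)} (hF : ↑F ⊆ 𝒜) {p : Set (List ℕ)} (hp : p ⊆ selectedSubtree T g) :
    ForcesInfinite p (branchName F) := by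
  intro q hq hqp k
  have hfin : (g ⁻¹' ↑F).Finite := F.finite_toSet.preimage hinj.injOn
  obtain ⟨L, hL⟩ := (hfin.image List.length).bddAbove
  obtain ⟨s, hs, hsL, hinf⟩ := hq.exists_long_splitting (L + 1)
  have hsF : g s ∉ F := fun h => by
    have := hL (Set.mem_image_of_mem List.length (show s ∈ g ⁻¹' ↑F from h))
    omega
  have hsub : sucT q s ⊆ g s := fun n hn => (hp (hqp hn)).2.2 s n List.prefix_rfl
  have hinf' := had.infinite_diff_biUnion hF (hg s) hsF
    ((Set.inter_eq_left.2 hsub).symm ▸ hinf)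
  obtain ⟨n, ⟨⟨hns, -⟩, hnF⟩, hnk⟩ := hinf'.exists_gt k
  refine ⟨nodeRestrict q (s ++ [n]), hq.nodeRestrict hns, nodeRestrict_subset _ _, n, hnk.le,
    hq.nodeRestrict hns, hnF, (s ++ [n]).length, fun t ht hlen => ?_⟩
  have hpre : s ++ [n] <+: t := by
    rcases ht.2 with h | h
    · rw [h.eq_of_length_le hlen]
    · exact h
  exact hpre.subset (by simp)

/-- Every Miller-indestructible MAD family is `+`-Ramsey. -/
theorem stmt5 (𝒜 : Set (Set ℕ)) (hmad : IsMAD 𝒜)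
    (hind : MillerIndestructible 𝒜) : PlusRamsey 𝒜 := by
  classical
  intro T hnil hT hpos
  let c : List ℕ → List ℕ := fun s => if s ∈ T then s else []
  have hc : ∀ s, c s ∈ T := fun s => by
    by_cases h : s ∈ T <;> simp [c, h, hnil]
  obtain ⟨g, hinj, hg⟩ := exists_injective_forall_mem
    (fun s => {A | A ∈ 𝒜 ∧ (sucT T (c s) ∩ A).Infinite})
    fun s => hmad.infinite_meeting_of_positive (hpos _ (hc s))
  have hS : IsMiller (selectedSubtree T g) := isMiller_selectedSubtree hnil hT fun s hs => by
    simpa [c, hs] using (hg s).2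
  obtain ⟨f, hf, hfpos⟩ := exists_branch_positive hmad.1 hind hS fun F hF p _ hpS =>
    forcesInfinite_branchName hmad.1 hinj (fun s => (hg s).1) hF hpS
  exact ⟨f, fun n => (hf n).1, hfpos⟩
end

section
/- The least cardinality of a Miller-tree splitting family equals the splitting number 𝔰. -/
/-- `S` tree-splits the Miller tree `p`. -/
def TreeSplits (S : Set ℕ) (p : Set (List ℕ)) : Prop :=
  (∃ q, IsMiller q ∧ q ⊆ p ∧ ∀ X ∈ splitSets q, X.Infinite ∧ X ⊆ S) ∧
  (∃ q, IsMiller q ∧ q ⊆ p ∧ ∀ X ∈ splitSets q, X.Infinite ∧ X ⊆ Set.univ \ S)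

/-- The splitting number `𝔰`. -/
noncomputable def sNum : Cardinal :=
  sInf {c | ∃ 𝒮 : Set (Set ℕ), Cardinal.mk ↥𝒮 = c ∧
    ∀ X : Set ℕ, X.Infinite → ∃ S ∈ 𝒮, (X ∩ S).Infinite ∧ (X \ S).Infinite}

/-- A Miller tree-splitting family. -/
def IsMTSF (𝒮 : Set (Set ℕ)) : Prop :=
  (∀ S ∈ 𝒮, S.Infinite) ∧ ∀ p, IsMiller p → ∃ S ∈ 𝒮, TreeSplits S p

theorem res_succ (f : ℕ → ℕ) (n : ℕ) : res f (n + 1) = res f n ++ [f n] := by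
  simp [res, List.range_succ]

theorem length_res (f : ℕ → ℕ) (n : ℕ) : (res f n).length = n := by
  simp [res]

theorem res_prefix_res (f : ℕ → ℕ) {m n : ℕ} (h : m ≤ n) : res f m <+: res f n := by
  induction n, h using Nat.le_induction with
  | base => exact List.prefix_rfl
  | succ n _ ih => exact ih.trans (by rw [res_succ]; exact List.prefix_append _ _)

/-- A branch can be built one entry at a time, keeping a prescribed relation between each
initial segment and the next entry. -/
theorem exists_branch {p : Set (List ℕ)} {P : List ℕ → ℕ → Prop} (h0 : [] ∈ p)
    (h : ∀ s ∈ p, ∃ a, s ++ [a] ∈ p ∧ P s a) :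
    ∃ f, IsBranch p f ∧ ∀ n, P (res f n) (f n) := by
  choose! a ha hP using h
  let s : ℕ → List ℕ := fun n => Nat.rec [] (fun _ s => s ++ [a s]) n
  have hs : ∀ n, res (fun n => a (s n)) n = s n := by
    intro n
    induction n with
    | zero => rfl
    | succ n ih => rw [res_succ, ih]
  have hp : ∀ n, s n ∈ p := by
    intro n
    induction n with
    | zero => exact h0
    | succ n ih => exact ha _ ih
  refine ⟨fun n => a (s n), fun n => ?_, fun n => ?_⟩
  · rw [hs]; exact hp n
  · rw [hs]; exact hP _ (hp n)

theorem IsMiller.nil_mem {p : Set (List ℕ)} (hp : IsMiller p) : [] ∈ p := by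
  obtain ⟨⟨s, hs⟩, ht, -⟩ := hp
  exact ht s hs _ List.nil_prefix

theorem IsMiller.exists_succ {p : Set (List ℕ)} (hp : IsMiller p) {s : List ℕ} (hs : s ∈ p) :
    ∃ a, s ++ [a] ∈ p := by
  obtain ⟨t, ht, ⟨u, rfl⟩, hinf⟩ := hp.2.2.2 s hs
  cases u with
  | nil =>
    obtain ⟨a, ha⟩ := hinf.nonempty
    exact ⟨a, by simpa [sucT] using ha⟩
  | cons a u => exact ⟨a, hp.2.1 _ ht _ ⟨u, by simp⟩⟩

theorem IsMiller.exists_isBranch {p : Set (List ℕ)} (hp : IsMiller p) : ∃ f, IsBranch p f := by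
  obtain ⟨f, hf, -⟩ := exists_branch (P := fun _ _ => True) hp.nil_mem
    fun s hs => (hp.exists_succ hs).imp fun a ha => ⟨ha, trivial⟩
  exact ⟨f, hf⟩

theorem IsMiller.strictMono {p : Set (List ℕ)} (hp : IsMiller p) {f : ℕ → ℕ}
    (hf : IsBranch p f) : StrictMono f := by
  refine strictMono_nat_of_lt_succ fun n => ?_
  have h := hp.2.2.1 _ (hf (n + 2))
  rw [res_succ, res_succ, List.append_assoc] at h
  have h2 := h.suffix (List.suffix_append _ _)
  simpa using h2

/-- `q` is a Miller subtree of `p` all of whose split sets are infinite subsets of `Y`. -/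
def IsSplitSubtree (p : Set (List ℕ)) (Y : Set ℕ) (q : Set (List ℕ)) : Prop :=
  IsMiller q ∧ q ⊆ p ∧ ∀ X ∈ splitSets q, X.Infinite ∧ X ⊆ Y

/-- The tree whose splitting nodes are values of `t`: `Anchored t Y U s r` says that `r` is a node
lying between the node `s` and the splitting node `t s`, where every splitting node is continued
by entries in `Y` leading to nodes in `U`. -/
inductive Anchored (t : List ℕ → List ℕ) (Y : Set ℕ) (U : Set (List ℕ)) :
    List ℕ → List ℕ → Prop
  | nil : Anchored t Y U [] []
  | step (s r : List ℕ) (a : ℕ) : Anchored t Y U s r → r ≠ t s → r ++ [a] <+: t s →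
      Anchored t Y U s (r ++ [a])
  | split (s : List ℕ) (a : ℕ) : Anchored t Y U s (t s) → a ∈ Y → t s ++ [a] ∈ U →
      Anchored t Y U (t s ++ [a]) (t s ++ [a])

namespace Anchored

variable {t : List ℕ → List ℕ} {Y : Set ℕ} {U : Set (List ℕ)}

theorem inv {s' r : List ℕ} {a : ℕ} (h : Anchored t Y U s' (r ++ [a])) :
    ∃ s, Anchored t Y U s r ∧
      ((s' = s ∧ r ≠ t s ∧ r ++ [a] <+: t s) ∨ (s' = r ++ [a] ∧ r = t s ∧ a ∈ Y)) := by
  generalize hu : r ++ [a] = u at h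
  cases h with
  | nil => simp at hu
  | step s r' b h1 h2 h3 =>
    obtain ⟨rfl, hb⟩ := List.append_inj' hu rfl
    exact ⟨s', h1, Or.inl ⟨rfl, h2, h3⟩⟩
  | split s b h1 h2 h3 =>
    obtain ⟨rfl, hb⟩ := List.append_inj' hu rfl
    obtain rfl : a = b := by simpa using hb
    exact ⟨s, h1, Or.inr ⟨rfl, rfl, h2⟩⟩

theorem unique {r : List ℕ} :
    ∀ {s s' : List ℕ}, Anchored t Y U s r → Anchored t Y U s' r → s = s' := by
  induction r using List.reverseRecOn with
  | nil =>
    have key : ∀ {s u : List ℕ}, Anchored t Y U s u → u = [] → s = [] := by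
      intro s u h hu
      cases h <;> simp_all
    intro s s' h h'
    rw [key h rfl, key h' rfl]
  | append_singleton r a ih =>
    intro s s' h h'
    obtain ⟨u, hu, h1⟩ := h.inv
    obtain ⟨u', hu', h1'⟩ := h'.inv
    obtain rfl := ih hu hu'
    rcases h1 with ⟨rfl, h2, -⟩ | ⟨rfl, h2, -⟩ <;> rcases h1' with ⟨rfl, h3, -⟩ | ⟨rfl, h3, -⟩
    · rfl
    · exact absurd h3 h2
    · exact absurd h2 h3
    · rfl

theorem mem_and_prefix (h0 : [] ∈ U) (hst : ∀ s ∈ U, s <+: t s) {s r : List ℕ}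
    (h : Anchored t Y U s r) : s ∈ U ∧ r <+: t s := by
  induction h with
  | nil => exact ⟨h0, List.nil_prefix⟩
  | step s r a _ _ h3 ih => exact ⟨ih.1, h3⟩
  | split s a _ _ h3 _ => exact ⟨h3, hst _ h3⟩

theorem anchor (h0 : [] ∈ U) (hst : ∀ s ∈ U, s <+: t s) {s r : List ℕ}
    (h : Anchored t Y U s r) : Anchored t Y U s (t s) := by
  have hpre := (h.mem_and_prefix h0 hst).2
  obtain ⟨u, hu⟩ := hpre
  induction u generalizing r with
  | nil => rw [List.append_nil] at hu; rwa [hu] at h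
  | cons a u ih =>
    refine ih (h.step s r a ?_ ⟨u, by simpa using hu⟩) (by simpa using hu)
    intro hr
    rw [← hr] at hu
    simp at hu

end Anchored

/-- A fusion lemma: if every node of `U` reaches a node of `p` with infinitely many successors
in `U` given by elements of `Y`, then `p` has a Miller subtree with split sets in `Y`. -/
theorem exists_isSplitSubtree {p : Set (List ℕ)} (hp : IsMiller p) {Y : Set ℕ}
    {U : Set (List ℕ)} (hU : U.Nonempty)
    (h : ∀ s ∈ U, ∃ t ∈ p, s <+: t ∧ {a | a ∈ Y ∧ t ++ [a] ∈ U}.Infinite) :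
    ∃ q, IsSplitSubtree p Y q := by
  wlog h0 : [] ∈ U generalizing U
  · refine this (U := insert [] U) ⟨[], by simp⟩ ?_ (by simp)
    obtain ⟨u, hu⟩ := hU
    intro s hs
    rcases hs with rfl | hs
    · obtain ⟨t, ht, -, hinf⟩ := h u hu
      exact ⟨t, ht, List.nil_prefix, hinf.mono fun a ha => ⟨ha.1, Or.inr ha.2⟩⟩
    · obtain ⟨t, ht, hst, hinf⟩ := h s hs
      exact ⟨t, ht, hst, hinf.mono fun a ha => ⟨ha.1, Or.inr ha.2⟩⟩
  choose! t htp hst hinf using h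
  let q : Set (List ℕ) := {r | ∃ s, Anchored t Y U s r}
  have hpre {s r : List ℕ} (hs : Anchored t Y U s r) := hs.mem_and_prefix h0 hst
  have hqp : q ⊆ p := fun r ⟨s, hs⟩ => hp.2.1 _ (htp s (hpre hs).1) _ (hpre hs).2
  have hsplit {s r : List ℕ} (hs : Anchored t Y U s r) : (sucT q (t s)).Infinite :=
    (hinf s (hpre hs).1).mono fun a ha => ⟨_, (hs.anchor h0 hst).split s a ha.1 ha.2⟩
  have hmem {r : List ℕ} (hr : r ∈ SplitNodes q) : sucT q r ⊆ Y := by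
    obtain ⟨⟨s, hs⟩, hr⟩ := hr
    have hcases : ∀ a ∈ sucT q r, (r ≠ t s ∧ r ++ [a] <+: t s) ∨ (r = t s ∧ a ∈ Y) := by
      rintro a ⟨s', hs'⟩
      obtain ⟨u, hu, h1⟩ := hs'.inv
      obtain rfl := hs.unique hu
      exact h1.imp (·.2) (·.2)
    intro a ha
    rcases hcases a ha with ⟨hne, hap⟩ | h1
    · exfalso
      refine hr ((Set.finite_singleton a).subset fun b hb => ?_)
      rcases hcases b hb with ⟨-, hbp⟩ | h1
      · have := (List.prefix_of_prefix_length_le hap hbp (by simp)).eq_of_length (by simp)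
        simpa using this.symm
      · exact absurd h1.1 hne
    · exact h1.2
  have hmiller : IsMiller q := by
    refine ⟨⟨[], [], .nil⟩, ?_, fun s hs => hp.2.2.1 s (hqp hs), ?_⟩
    · rintro r hr r' ⟨u, rfl⟩
      induction u using List.reverseRecOn with
      | nil => simpa using hr
      | append_singleton u a ih =>
        rw [← List.append_assoc] at hr
        obtain ⟨s, hs⟩ := hr
        obtain ⟨u, hu, -⟩ := hs.inv
        exact ih ⟨u, hu⟩
    · rintro r ⟨s, hs⟩
      exact ⟨t s, ⟨s, hs.anchor h0 hst⟩, (hpre hs).2, hsplit hs⟩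
  refine ⟨q, hmiller, hqp, ?_⟩
  rintro _ ⟨f, hf, rfl⟩
  have hmono := hmiller.strictMono hf
  constructor
  · have hnext : ∀ d n s, Anchored t Y U s (res f n) → (t s).length = n + d →
        res f (n + d) ∈ SplitNodes q := by
      intro d
      induction d with
      | zero =>
        intro n s hs hd
        have h1 := (hpre hs).2.eq_of_length (by rw [length_res, hd, add_zero])
        exact ⟨hf _, by rw [add_zero, h1]; exact hsplit hs⟩
      | succ d ih =>
        intro n s hs hd
        obtain ⟨s', hs'⟩ := hf (n + 1)
        have hs2 := hs'
        rw [res_succ] at hs2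
        obtain ⟨u, hu, h1⟩ := hs2.inv
        obtain rfl := hs.unique hu
        rcases h1 with ⟨rfl, -, -⟩ | ⟨-, h2, -⟩
        · have := ih (n + 1) s' hs' (by omega)
          rwa [show n + 1 + d = n + (d + 1) by omega] at this
        · have := congrArg List.length h2
          rw [length_res] at this
          omega
    have hinfn : {n | res f n ∈ SplitNodes q}.Infinite := by
      refine Set.infinite_of_not_bddAbove ?_
      rintro ⟨N, hN⟩
      obtain ⟨s, hs⟩ := hf (N + 1)
      have hle := (hpre hs).2.length_le
      rw [length_res] at hle
      obtain ⟨d, hd⟩ := Nat.exists_eq_add_of_le hle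
      have := hN (hnext d _ s hs hd)
      omega
    refine (hinfn.image hmono.injective.injOn).mono ?_
    rintro _ ⟨n, hn, rfl⟩
    exact ⟨n, hn, rfl⟩
  · rintro _ ⟨n, hn, rfl⟩
    refine hmem hn ?_
    have := hf (n + 1)
    rwa [res_succ] at this

/-- The rank of a node `s` of `p` is at most `α`: above `s`, almost all successors given by
elements of `Y` have smaller rank. -/
def Ranked (p : Set (List ℕ)) (Y : Set ℕ) (α : Ordinal.{0}) (s : List ℕ) : Prop :=
  ∀ t ∈ p, s <+: t → ∃ g, ∀ a, g ≤ a → a ∈ Y → t ++ [a] ∈ p →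
    ∃ β, ∃ _ : β < α, Ranked p Y β (t ++ [a])
termination_by α

theorem Ranked.of_prefix {p : Set (List ℕ)} {Y : Set ℕ} {α : Ordinal.{0}} {s s' : List ℕ}
    (h : Ranked p Y α s) (hs : s <+: s') : Ranked p Y α s' := by
  rw [Ranked] at h ⊢
  exact fun t ht hst => h t ht (hs.trans hst)

theorem exists_ranked {p : Set (List ℕ)} (hp : IsMiller p) {Y : Set ℕ}
    (hq : ¬ ∃ q, IsSplitSubtree p Y q) {s : List ℕ} (hs : s ∈ p) : ∃ α, Ranked p Y α s := by
  by_contra hcon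
  refine hq (exists_isSplitSubtree hp (U := {s | s ∈ p ∧ ¬ ∃ α, Ranked p Y α s}) ⟨s, hs, hcon⟩ ?_)
  rintro s ⟨hs, hcon⟩
  let α : Ordinal.{0} := ⨆ u : List ℕ, Order.succ (sInf {β | Ranked p Y β u})
  have hα : ¬ Ranked p Y α s := fun h => hcon ⟨α, h⟩
  by_contra! hfin
  apply hα
  rw [Ranked]
  intro t ht hst
  obtain ⟨g, hg⟩ := (hfin t ht hst).bddAbove
  refine ⟨g + 1, fun a hga haY hap => ?_⟩
  have hex : ∃ β, Ranked p Y β (t ++ [a]) := by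
    by_contra hno
    have : a ≤ g := hg ⟨haY, hap, fun β hβ => hno ⟨β, hβ⟩⟩
    omega
  refine ⟨sInf {β | Ranked p Y β (t ++ [a])}, ?_, csInf_mem hex⟩
  exact (Order.lt_succ _).trans_le
    (Ordinal.le_iSup (fun u : List ℕ => Order.succ (sInf {β | Ranked p Y β u})) (t ++ [a]))

/-- If `p` has no Miller subtree with split sets in `Y`, then along every sufficiently fast
growing branch only finitely many splitting values lie in `Y`. -/
theorem exists_bound_of_no_isSplitSubtree {p : Set (List ℕ)} (hp : IsMiller p) {Y : Set ℕ}
    (hq : ¬ ∃ q, IsSplitSubtree p Y q) :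
    ∃ g : List ℕ → ℕ, ∀ f, IsBranch p f →
      (∃ N, ∀ n ≥ N, res f n ∈ SplitNodes p → g (res f n) ≤ f n) → (Sp p f ∩ Y).Finite := by
  let rk : List ℕ → Ordinal.{0} := fun s => sInf {α | Ranked p Y α s}
  have hrk : ∀ s ∈ p, Ranked p Y (rk s) s := fun s hs =>
    csInf_mem (s := {α | Ranked p Y α s}) (exists_ranked hp hq hs)
  have hdrop : ∀ s ∈ p, ∃ g, ∀ a, g ≤ a → a ∈ Y → s ++ [a] ∈ p → rk (s ++ [a]) < rk s := by
    intro s hs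
    have h := hrk s hs
    rw [Ranked] at h
    obtain ⟨g, hg⟩ := h s hs List.prefix_rfl
    refine ⟨g, fun a h1 h2 h3 => ?_⟩
    obtain ⟨β, hβ, hr⟩ := hg a h1 h2 h3
    exact (csInf_le' (s := {α | Ranked p Y α (s ++ [a])}) hr).trans_lt hβ
  choose! g hg using hdrop
  refine ⟨g, fun f hf ⟨N, hN⟩ => ?_⟩
  have hanti : ∀ {m n : ℕ}, m ≤ n → rk (res f n) ≤ rk (res f m) := fun hmn =>
    csInf_le' (s := {α | Ranked p Y α (res f _)})
      ((hrk _ (hf _)).of_prefix (res_prefix_res f hmn))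
  obtain ⟨_, ⟨n₀, rfl⟩, hmin⟩ := WellFounded.has_min (wellFounded_lt (α := Ordinal.{0}))
    (Set.range fun n => rk (res f n)) ⟨_, 0, rfl⟩
  refine ((Set.finite_lt_nat (max N n₀)).image f).subset ?_
  rintro _ ⟨⟨n, hsp, rfl⟩, hY⟩
  refine ⟨n, ?_, rfl⟩
  by_contra hn
  have hn : max N n₀ ≤ n := not_lt.1 hn
  have h1 := hf (n + 1)
  rw [res_succ] at h1
  have h2 := hg _ (hf n) (f n) (hN n (le_trans (le_max_left _ _) hn) hsp) hY h1
  rw [← res_succ] at h2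
  exact hmin _ ⟨n + 1, rfl⟩ (h2.trans_le (hanti (le_trans (le_max_right _ _) hn)))

/-- A splitting family. -/
def IsSplitting (𝒮 : Set (Set ℕ)) : Prop :=
  ∀ X : Set ℕ, X.Infinite → ∃ S ∈ 𝒮, (X ∩ S).Infinite ∧ (X \ S).Infinite

/-- Every family of functions indexed by `ι` is bounded modulo finite. -/
def FamiliesBounded (ι : Type) : Prop :=
  ∀ g : ι → ℕ → ℕ, ∃ h : ℕ → ℕ, ∀ i, ∃ N, ∀ k ≥ N, g i k ≤ h k

theorem TreeSplits.infinite {S : Set ℕ} {p : Set (List ℕ)} (h : TreeSplits S p) :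
    S.Infinite := by
  obtain ⟨⟨q, hq, -, hS⟩, -⟩ := h
  obtain ⟨f, hf⟩ := hq.exists_isBranch
  obtain ⟨h1, h2⟩ := hS _ ⟨f, hf, rfl⟩
  exact h1.mono h2

theorem TreeSplits.mono {S : Set ℕ} {p p' : Set (List ℕ)} (h : TreeSplits S p) (hp : p ⊆ p') :
    TreeSplits S p' := by
  obtain ⟨⟨q, h1, h2, h3⟩, ⟨q', h1', h2', h3'⟩⟩ := h
  exact ⟨⟨q, h1, h2.trans hp, h3⟩, ⟨q', h1', h2'.trans hp, h3'⟩⟩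

theorem treeSplits_of_forall_splits {S : Set ℕ} {p : Set (List ℕ)} (hp : IsMiller p)
    (h : ∀ t ∈ SplitNodes p, (sucT p t ∩ S).Infinite ∧ (sucT p t \ S).Infinite) :
    TreeSplits S p := by
  have key : ∀ Y : Set ℕ, (∀ t ∈ SplitNodes p, (sucT p t ∩ Y).Infinite) →
      ∃ q, IsSplitSubtree p Y q := by
    intro Y hY
    refine exists_isSplitSubtree hp hp.1 fun s hs => ?_
    obtain ⟨t, ht, hst, hinf⟩ := hp.2.2.2 s hs
    exact ⟨t, ht, hst, (hY t ⟨ht, hinf⟩).mono fun a ha => ⟨ha.2, ha.1⟩⟩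
  refine ⟨key S fun t ht => (h t ht).1, key _ fun t ht => (h t ht).2.mono ?_⟩
  exact fun a ha => ⟨ha.1, trivial, ha.2⟩

/-- Below the bounding number, splitting families are Miller tree-splitting. -/
theorem exists_treeSplits_of_bounded {𝒮 : Set (Set ℕ)} (h𝒮 : IsSplitting 𝒮)
    (hb : FamiliesBounded 𝒮) {p : Set (List ℕ)} (hp : IsMiller p) :
    ∃ S ∈ 𝒮, TreeSplits S p := by
  obtain ⟨p', hp', hsub, hSp⟩ : ∃ q, IsSplitSubtree p Set.univ q := by
    refine exists_isSplitSubtree hp hp.1 fun s hs => ?_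
    obtain ⟨t, ht, hst, hinf⟩ := hp.2.2.2 s hs
    exact ⟨t, ht, hst, hinf.mono fun a ha => ⟨trivial, ha⟩⟩
  by_contra! hcon
  have hg : ∀ S : 𝒮, ∃ g : List ℕ → ℕ, ∀ f, IsBranch p' f →
      (∃ N, ∀ n ≥ N, res f n ∈ SplitNodes p' → g (res f n) ≤ f n) →
        (Sp p' f ∩ S).Finite ∨ (Sp p' f \ S).Finite := by
    intro S
    have hS : ¬ TreeSplits S p' := fun h => hcon S S.2 (h.mono hsub)
    rcases not_and_or.1 hS with h | h
    · obtain ⟨g, hg⟩ := exists_bound_of_no_isSplitSubtree hp' h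
      exact ⟨g, fun f hf hN => Or.inl (hg f hf hN)⟩
    · obtain ⟨g, hg⟩ := exists_bound_of_no_isSplitSubtree hp' h
      exact ⟨g, fun f hf hN => Or.inr ((hg f hf hN).subset fun a ha => ⟨ha.1, trivial, ha.2⟩)⟩
  choose g hg using hg
  let e : List ℕ ≃ ℕ := Denumerable.eqv (List ℕ)
  obtain ⟨h, hh⟩ := hb fun S k => g S (e.symm k)
  obtain ⟨f, hf, hfh⟩ := exists_branch (P := fun s a => (sucT p' s).Infinite → h (e s) ≤ a)
    hp'.nil_mem fun s hs => by
      by_cases hinf : (sucT p' s).Infinite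
      · obtain ⟨a, ha, hlt⟩ := hinf.exists_gt (h (e s))
        exact ⟨a, ha, fun _ => hlt.le⟩
      · exact (hp'.exists_succ hs).imp fun a ha => ⟨ha, fun h => absurd h hinf⟩
  obtain ⟨S, hS, h1, h2⟩ := h𝒮 _ (hSp _ ⟨f, hf, rfl⟩).1
  have hinj : Function.Injective fun n => e (res f n) := fun m n hmn => by
    simpa [length_res] using congrArg List.length (e.injective hmn)
  obtain ⟨N, hN⟩ := hh ⟨S, hS⟩
  obtain ⟨M, hM⟩ := Filter.eventually_atTop.1 (hinj.nat_tendsto_atTop.eventually_ge_atTop N)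
  have hfin := hg ⟨S, hS⟩ f hf ⟨M, fun n hn hsp => ?_⟩
  · exact hfin.elim h1 h2
  · have := hN _ (hM n hn)
    rw [Equiv.symm_apply_apply] at this
    exact this.trans (hfh n hsp.2)

/-- The endpoints of an interval partition growing faster than `g`. -/
def endpoint (g : ℕ → ℕ) : ℕ → ℕ
  | 0 => 0
  | n + 1 => endpoint g n + 1 + ∑ i ∈ Finset.range (endpoint g n + 1), g i

/-- The union of those intervals of the partition given by `g` whose index lies in `S`. -/
def blockUnion (g : ℕ → ℕ) (S : Set ℕ) : Set ℕ :=
  {x | ∃ n ∈ S, endpoint g n ≤ x ∧ x < endpoint g (n + 1)}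

theorem endpoint_strictMono (g : ℕ → ℕ) : StrictMono (endpoint g) :=
  strictMono_nat_of_lt_succ fun n => by rw [endpoint]; omega

theorem lt_endpoint_succ (g : ℕ → ℕ) {n k : ℕ} (h : k ≤ endpoint g n) :
    g k < endpoint g (n + 1) := by
  have := Finset.single_le_sum (f := g) (fun i _ => Nat.zero_le _)
    (Finset.mem_range.2 (Nat.lt_succ_of_le h))
  rw [endpoint]
  simp only [Nat.succ_eq_add_one] at this
  omega

theorem endpoint_index_unique (g : ℕ → ℕ) {m n x : ℕ} (h1 : endpoint g m ≤ x)
    (h2 : x < endpoint g (m + 1)) (h3 : endpoint g n ≤ x) (h4 : x < endpoint g (n + 1)) :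
    m = n := by
  have ha := (endpoint_strictMono g).lt_iff_lt.1 (h1.trans_lt h4)
  have hb := (endpoint_strictMono g).lt_iff_lt.1 (h3.trans_lt h2)
  omega

theorem infinite_endpoint {g φ : ℕ → ℕ} (hφ : Monotone φ)
    (hg : ∀ N, ∃ k ≥ N, φ (φ k) < g k) :
    {n | φ (endpoint g n) ≤ endpoint g (n + 1)}.Infinite := by
  refine Set.infinite_of_not_bddAbove ?_
  rintro ⟨N, hN⟩
  have hbig : ∀ n, N < n → endpoint g (n + 1) < φ (endpoint g n) := fun n hn => by
    by_contra h
    exact absurd (hN (not_lt.1 h)) (by omega)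
  obtain ⟨k, hk, hlt⟩ := hg (endpoint g (N + 1))
  obtain ⟨n, hn1, hn2⟩ : ∃ n, endpoint g n ≤ k ∧ k < endpoint g (n + 1) := by
    have hex : ∃ n, k < endpoint g n :=
      ⟨k + 1, lt_of_lt_of_le (Nat.lt_succ_self k) (endpoint_strictMono g).le_apply⟩
    obtain ⟨m, hm⟩ : ∃ m, Nat.find hex = m + 1 := by
      refine Nat.exists_eq_succ_of_ne_zero fun h0 => ?_
      have := Nat.find_spec hex
      rw [h0, endpoint] at this
      omega
    refine ⟨m, not_lt.1 (Nat.find_min hex (by omega)), ?_⟩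
    rw [← hm]
    exact Nat.find_spec hex
  have hNn : N < n := by
    have := (endpoint_strictMono g).lt_iff_lt.1 (hk.trans_lt hn2)
    omega
  have h1 := hbig n hNn
  have h2 := hbig (n + 1) (by omega)
  have h3 := lt_endpoint_succ g hn2.le
  have h4 := hφ (h1.le.trans (hφ hn1))
  omega

/-- Splitting and unbounded families combine to split countably many sets simultaneously. -/
theorem exists_blockUnion_splits {𝒮 : Set (Set ℕ)} (h𝒮 : IsSplitting 𝒮) {ι : Type}
    {g : ι → ℕ → ℕ} (hg : ¬ ∃ h : ℕ → ℕ, ∀ i, ∃ N, ∀ k ≥ N, g i k ≤ h k)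
    (A : ℕ → Set ℕ) :
    ∃ i, ∃ S ∈ 𝒮, ∀ m, (A m).Infinite →
      (A m ∩ blockUnion (g i) S).Infinite ∧ (A m \ blockUnion (g i) S).Infinite := by
  have hnext : ∀ m k, ∃ b, (A m).Infinite → b ∈ A m ∧ k ≤ b := by
    intro m k
    by_cases h : (A m).Infinite
    · obtain ⟨b, hb, hlt⟩ := h.exists_gt k
      exact ⟨b, fun _ => ⟨hb, hlt.le⟩⟩
    · exact ⟨0, fun h' => absurd h' h⟩
  choose b hb using hnext
  let φ : ℕ → ℕ := fun k => ∑ j ∈ Finset.range (k + 1), ∑ m ∈ Finset.range (k + 1), (b m j + 1)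
  have hφ : Monotone φ := by
    intro k l hkl
    have hsub : Finset.range (k + 1) ⊆ Finset.range (l + 1) :=
      Finset.range_subset_range.2 (by omega)
    exact (Finset.sum_le_sum fun j _ => Finset.sum_le_sum_of_subset hsub).trans
      (Finset.sum_le_sum_of_subset hsub)
  have hbφ : ∀ m k, m ≤ k → b m k < φ k := by
    intro m k hmk
    have h1 := Finset.single_le_sum (f := fun m => b m k + 1) (fun i _ => Nat.zero_le _)
      (Finset.mem_range.2 (Nat.lt_succ_of_le hmk))
    have h2 := Finset.single_le_sum (f := fun j => ∑ m ∈ Finset.range (k + 1), (b m j + 1))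
      (fun i _ => Nat.zero_le _) (Finset.mem_range.2 (Nat.lt_succ_self k))
    exact Nat.lt_of_succ_le (h1.trans h2)
  obtain ⟨i, hi⟩ : ∃ i, ∀ N, ∃ k ≥ N, φ (φ k) < g i k := by
    by_contra! hcon
    exact hg ⟨fun k => φ (φ k), hcon⟩
  obtain ⟨S, hS, h1, h2⟩ := h𝒮 _ (infinite_endpoint hφ hi)
  have key : ∀ (m : ℕ) (Z : Set ℕ) (B : Set ℕ), (A m).Infinite →
      ({n | φ (endpoint (g i) n) ≤ endpoint (g i) (n + 1)} ∩ Z).Infinite →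
      (∀ n ∈ Z, ∀ x, endpoint (g i) n ≤ x → x < endpoint (g i) (n + 1) → x ∈ B) →
      (A m ∩ B).Infinite := by
    intro m Z B hA hZ hB
    refine Set.infinite_of_forall_exists_gt fun k => ?_
    obtain ⟨n, ⟨hn, hnZ⟩, hlt⟩ := hZ.exists_gt (max m k)
    have hle : n ≤ endpoint (g i) n := (endpoint_strictMono (g i)).le_apply
    have h3 := hb m (endpoint (g i) n) hA
    have h4 := hbφ m (endpoint (g i) n) (by omega)
    have hn : φ (endpoint (g i) n) ≤ endpoint (g i) (n + 1) := hn
    exact ⟨b m (endpoint (g i) n), ⟨h3.1, hB n hnZ _ h3.2 (by omega)⟩, by omega⟩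
  refine ⟨i, S, hS, fun m hA => ⟨key m S _ hA h1 fun n hn x hx hx' => ⟨n, hn, hx, hx'⟩,
    key m Sᶜ _ hA h2 ?_⟩⟩
  rintro n hn x hx hx' ⟨n', hn', hx1, hx2⟩
  exact hn (endpoint_index_unique (g i) hx1 hx2 hx hx' ▸ hn')

theorem familiesBounded_of_finite (ι : Type) [Finite ι] : FamiliesBounded ι := by
  have := Fintype.ofFinite ι
  exact fun g => ⟨fun k => ∑ i, g i k, fun i => ⟨0, fun k _ =>
    Finset.single_le_sum (f := fun i => g i k) (fun i _ => Nat.zero_le _) (Finset.mem_univ i)⟩⟩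

theorem IsSplitting.exists_isMTSF {𝒮 : Set (Set ℕ)} (h𝒮 : IsSplitting 𝒮) :
    ∃ 𝒯, IsMTSF 𝒯 ∧ Cardinal.mk 𝒯 ≤ Cardinal.mk 𝒮 := by
  suffices h : ∃ 𝒯 : Set (Set ℕ), (∀ p, IsMiller p → ∃ S ∈ 𝒯, TreeSplits S p) ∧
      Cardinal.mk 𝒯 ≤ Cardinal.mk 𝒮 by
    obtain ⟨𝒯, h1, h2⟩ := h
    refine ⟨{S ∈ 𝒯 | S.Infinite}, ⟨fun S hS => hS.2, fun p hp => ?_⟩,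
      (Cardinal.mk_le_mk_of_subset fun S hS => hS.1).trans h2⟩
    obtain ⟨S, hS, hSp⟩ := h1 p hp
    exact ⟨S, ⟨hS, hSp.infinite⟩, hSp⟩
  by_cases hb : FamiliesBounded 𝒮
  · exact ⟨𝒮, fun p hp => exists_treeSplits_of_bounded h𝒮 hb hp, le_rfl⟩
  have hinf : Cardinal.aleph0 ≤ Cardinal.mk 𝒮 := by
    rw [Cardinal.aleph0_le_mk_iff, ← not_finite_iff_infinite]
    exact fun h => hb (familiesBounded_of_finite 𝒮)
  obtain ⟨g, hg⟩ := not_forall.1 hb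
  refine ⟨Set.range fun x : 𝒮 × 𝒮 => blockUnion (g x.1) x.2, fun p hp => ?_, ?_⟩
  · obtain ⟨i, S, hS, h⟩ := exists_blockUnion_splits h𝒮 hg
      fun m => sucT p ((Denumerable.eqv (List ℕ)).symm m)
    refine ⟨_, ⟨(i, ⟨S, hS⟩), rfl⟩, treeSplits_of_forall_splits hp fun t ht => ?_⟩
    have := h (Denumerable.eqv (List ℕ) t)
    rw [Equiv.symm_apply_apply] at this
    exact this ht.2
  · refine Cardinal.mk_range_le.trans ?_
    rw [Cardinal.mk_prod, Cardinal.lift_id, Cardinal.mul_eq_self hinf]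

theorem IsMTSF.isSplitting {𝒮 : Set (Set ℕ)} (h𝒮 : IsMTSF 𝒮) : IsSplitting 𝒮 := by
  intro X hX
  let p : Set (List ℕ) := {s | List.IsChain (· < ·) s ∧ ∀ x ∈ s, x ∈ X}
  have hp : IsMiller p := by
    refine ⟨⟨[], by simp [p]⟩, ?_, fun s hs => hs.1, ?_⟩
    · exact fun s hs t hts => ⟨hs.1.prefix hts, fun x hx => hs.2 x (hts.subset hx)⟩
    · intro s hs
      refine ⟨s, hs, List.prefix_rfl, Set.infinite_of_forall_exists_gt fun k => ?_⟩
      obtain ⟨a, ha, hlt⟩ := hX.exists_gt (k + s.sum)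
      refine ⟨a, ⟨?_, ?_⟩, by omega⟩
      · refine hs.1.append (by simp) ?_
        intro x hx y hy
        obtain rfl : a = y := by simpa using hy
        have := List.single_le_sum (l := s) (fun _ _ => Nat.zero_le _) x (List.mem_of_getLast? hx)
        omega
      · intro x hx
        rcases List.mem_append.1 hx with h | h
        · exact hs.2 x h
        · rwa [List.mem_singleton.1 h]
  have key : ∀ Y q, IsSplitSubtree p Y q → (X ∩ Y).Infinite := by
    rintro Y q ⟨hq, hqp, h⟩
    obtain ⟨f, hf⟩ := hq.exists_isBranch
    obtain ⟨h1, h2⟩ := h _ ⟨f, hf, rfl⟩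
    refine h1.mono fun a ha => ⟨?_, h2 ha⟩
    obtain ⟨n, -, rfl⟩ := ha
    refine (hqp (hf (n + 1))).2 _ ?_
    rw [res_succ]
    simp
  obtain ⟨S, hS, ⟨q, h⟩, ⟨q', h'⟩⟩ := h𝒮.2 p hp
  exact ⟨S, hS, key S q h, (key _ q' h').mono fun a ha => ⟨ha.1, ha.2.2⟩⟩

/-- The least size of a Miller tree-splitting family is the splitting number `𝔰`. -/
theorem stmt11 :
    sInf {c | ∃ 𝒮 : Set (Set ℕ), IsMTSF 𝒮 ∧ Cardinal.mk ↥𝒮 = c} = sNum := by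
  have hsub : {c | ∃ 𝒮 : Set (Set ℕ), IsMTSF 𝒮 ∧ Cardinal.mk ↥𝒮 = c} ⊆
      {c | ∃ 𝒮 : Set (Set ℕ), Cardinal.mk ↥𝒮 = c ∧ IsSplitting 𝒮} := by
    rintro c ⟨𝒮, h, hc⟩
    exact ⟨𝒮, hc, h.isSplitting⟩
  change _ = sInf {c | ∃ 𝒮 : Set (Set ℕ), Cardinal.mk ↥𝒮 = c ∧ IsSplitting 𝒮}
  rcases Set.eq_empty_or_nonempty
    {c | ∃ 𝒮 : Set (Set ℕ), Cardinal.mk ↥𝒮 = c ∧ IsSplitting 𝒮} with he | hne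
  · rw [he] at hsub ⊢
    rw [Set.subset_empty_iff.1 hsub]
  · refine le_antisymm (le_csInf hne ?_) ?_
    · rintro c ⟨𝒮, rfl, h⟩
      obtain ⟨𝒯, hT, hle⟩ := h.exists_isMTSF
      exact le_trans (csInf_le (OrderBot.bddBelow _) ⟨𝒯, hT, rfl⟩) hle
    · obtain ⟨c, 𝒮, rfl, h⟩ := hne
      obtain ⟨𝒯, hT, -⟩ := h.exists_isMTSF
      exact csInf_le_csInf (OrderBot.bddBelow _) ⟨_, 𝒯, hT, rfl⟩ hsub
end
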